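/- Let 0 < j < 3^n − 1 with ternary digits j_i. Suppose j ∈ S_1, {j_0, j_{(n−k) mod n}} = {1, 2}, and {j_1, j_{(1−k) mod n}} = {0, 1}. Then (j_1, j_0) = (1, 2) or (0, 1). -/

import Mathlib

/-- The `i`-th ternary digit (indices read modulo `n`) of the residue of `j` modulo `3^n - 1`. -/
def dig (n : ℕ) (j : ℤ) (i : ℕ) : ℕ :=
  ((j % ((3 : ℤ) ^ n - 1)).toNat / 3 ^ (i % n)) % 3

/-- The ternary weight of (the residue modulo `3^n - 1` of) `j`. -/
def wt (n : ℕ) (j : ℤ) : ℕ := ∑ i ∈ Finset.range n, dig n j i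

/-- `d = (3^k + 1)/2`. -/
def cmD (k : ℕ) : ℤ := ((3 : ℤ) ^ k + 1) / 2

/-- The set `S_1`. -/
def S1 (n k : ℕ) : Set ℤ :=
  {j | 0 < j ∧ j < 3 ^ n - 1 ∧
    wt n j + wt n (3 ^ k * j) = wt n ((3 ^ k + 1) * j) + 2 ∧
    2 * wt n (-(j * cmD k)) = wt n (-((3 ^ k + 1) * j))}

theorem dig_lt_three (n : ℕ) (j : ℤ) (i : ℕ) : dig n j i < 3 := Nat.mod_lt _ (by norm_num)

theorem dig_mod (n : ℕ) (j : ℤ) (i : ℕ) : dig n j (i % n) = dig n j i := by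
  simp [dig]

theorem dig_congr {n i i' : ℕ} (h : i ≡ i' [MOD n]) (j : ℤ) : dig n j i = dig n j i' := by
  rw [← dig_mod n j i, h, dig_mod]

theorem emod_eq_natCast (n : ℕ) (hn : 0 < n) (j : ℤ) :
    ∃ A : ℕ, j % ((3 : ℤ) ^ n - 1) = A ∧ A + 1 < 3 ^ n := by
  have h3 : (1 : ℤ) < 3 ^ n := one_lt_pow₀ (by norm_num) hn.ne'
  have hpos : (0 : ℤ) < 3 ^ n - 1 := by linarith
  refine ⟨(j % ((3 : ℤ) ^ n - 1)).toNat, ?_, ?_⟩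
  · rw [Int.toNat_of_nonneg (Int.emod_nonneg _ hpos.ne')]
  · have h1 := Int.emod_nonneg j hpos.ne'
    have h2 := Int.emod_lt_of_pos j hpos
    zify
    rw [Int.toNat_of_nonneg h1]
    linarith

theorem dig_eq_of_emod {n : ℕ} {j : ℤ} {A i : ℕ} (h : j % ((3 : ℤ) ^ n - 1) = A) (hi : i < n) :
    dig n j i = A / 3 ^ i % 3 := by
  simp [dig, h, Nat.mod_eq_of_lt hi]

/-- Cyclic addition with carry of ternary residues modulo `3 ^ n - 1`; `t i` is the carry into
position `i`. -/
theorem exists_carry (n : ℕ) (hn : 0 < n) (a b : ℤ) :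
    ∃ t : ℕ → ℕ, t n = t 0 ∧ (∀ i, t i ≤ 1) ∧
      ∀ i < n, dig n a i + dig n b i + t i = dig n (a + b) i + 3 * t (i + 1) := by
  obtain ⟨A, hA, hA'⟩ := emod_eq_natCast n hn a
  obtain ⟨B, hB, hB'⟩ := emod_eq_natCast n hn b
  obtain ⟨S, hS, hS'⟩ := emod_eq_natCast n hn (a + b)
  obtain ⟨c, hc, hAB⟩ : ∃ c ≤ 1, A + B + c = S + 3 ^ n * c := by
    have hadd : (S : ℤ) = ((A : ℤ) + B) % (3 ^ n - 1) := by
      rw [← hS, ← hA, ← hB, Int.emod_add_emod, Int.add_emod_emod]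
    rcases lt_or_ge (A + B + 1) (3 ^ n) with h | h
    · refine ⟨0, by norm_num, ?_⟩
      zify at h
      rw [Int.emod_eq_of_lt (by positivity) (by linarith)] at hadd
      omega
    · refine ⟨1, le_rfl, ?_⟩
      zify at h hA' hB'
      rw [← Int.sub_emod_right, Int.emod_eq_of_lt (by linarith) (by linarith)] at hadd
      zify
      linarith
  have hp : ∀ i, 0 < 3 ^ i := fun i => by positivity
  refine ⟨fun i => (A % 3 ^ i + B % 3 ^ i + c) / 3 ^ i, ?_, fun i => ?_, fun i hi => ?_⟩
  · simp only [pow_zero, Nat.mod_one, Nat.div_one]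
    rw [Nat.mod_eq_of_lt (by omega), Nat.mod_eq_of_lt (by omega), hAB,
      Nat.add_mul_div_left _ _ (hp n), Nat.div_eq_of_lt (by omega)]
  · have := Nat.mod_lt A (hp i)
    have := Nat.mod_lt B (hp i)
    exact Nat.le_of_lt_succ ((Nat.div_lt_iff_lt_mul (hp i)).2 (by omega))
  · rw [dig_eq_of_emod hA hi, dig_eq_of_emod hB hi, dig_eq_of_emod hS hi]
    have hSi : S / 3 ^ i % 3 = (A + B + c) / 3 ^ i % 3 := by
      obtain ⟨m, rfl⟩ := Nat.exists_eq_add_of_lt hi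
      rw [hAB, show S + 3 ^ (i + m + 1) * c = S + 3 ^ i * (3 * (3 ^ m * c)) by ring,
        Nat.add_mul_div_left _ _ (hp i), Nat.add_mul_mod_self_left]
    have hdiv : (A + B + c) / 3 ^ i
        = A / 3 ^ i + B / 3 ^ i + (A % 3 ^ i + B % 3 ^ i + c) / 3 ^ i := by
      conv_lhs => rw [← Nat.div_add_mod A (3 ^ i), ← Nat.div_add_mod B (3 ^ i)]
      rw [show 3 ^ i * (A / 3 ^ i) + A % 3 ^ i + (3 ^ i * (B / 3 ^ i) + B % 3 ^ i) + c
        = A % 3 ^ i + B % 3 ^ i + c + 3 ^ i * (A / 3 ^ i + B / 3 ^ i) by ring,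
        Nat.add_mul_div_left _ _ (hp i)]
      ring
    have hnext : (A % 3 ^ (i + 1) + B % 3 ^ (i + 1) + c) / 3 ^ (i + 1)
        = (A / 3 ^ i % 3 + B / 3 ^ i % 3 + (A % 3 ^ i + B % 3 ^ i + c) / 3 ^ i) / 3 := by
      rw [pow_succ, Nat.mod_mul, Nat.mod_mul, ← Nat.div_div_eq_div_mul,
        show A % 3 ^ i + 3 ^ i * (A / 3 ^ i % 3) + (B % 3 ^ i + 3 ^ i * (B / 3 ^ i % 3)) + c
          = A % 3 ^ i + B % 3 ^ i + c + 3 ^ i * (A / 3 ^ i % 3 + B / 3 ^ i % 3) by ring,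
        Nat.add_mul_div_left _ _ (hp i)]
      congr 1
      ring
    simp only [hSi, hdiv, hnext]
    omega

theorem sum_carry_eq {n : ℕ} {a b : ℤ} {t : ℕ → ℕ} (ht : t n = t 0)
    (h : ∀ i < n, dig n a i + dig n b i + t i = dig n (a + b) i + 3 * t (i + 1)) :
    wt n a + wt n b = wt n (a + b) + 2 * ∑ i ∈ Finset.range n, t (i + 1) := by
  have hsum := Finset.sum_congr rfl fun i hi => h i (Finset.mem_range.1 hi)
  simp only [Finset.sum_add_distrib, ← Finset.mul_sum] at hsum
  have hcyc := (Finset.sum_range_succ t n).symm.trans (Finset.sum_range_succ' t n)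
  simp only [wt]
  omega

theorem dig_three_mul (n : ℕ) (hn : 0 < n) (j : ℤ) (i : ℕ) :
    dig n (3 * j) (i + 1) = dig n j i := by
  obtain ⟨m, rfl⟩ := Nat.exists_eq_succ_of_ne_zero hn.ne'
  obtain ⟨A, hA, hA'⟩ := emod_eq_natCast _ hn j
  have hp : 0 < 3 ^ m := by positivity
  have hlt := Nat.mod_lt A hp
  have hdm := Nat.div_add_mod A (3 ^ m)
  have hq : A / 3 ^ m < 3 := (Nat.div_lt_iff_lt_mul hp).2 (by
    rw [Nat.succ_eq_add_one, pow_succ] at hA'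
    omega)
  have hB : (3 * j) % ((3 : ℤ) ^ (m + 1) - 1) = (3 * (A % 3 ^ m) + A / 3 ^ m : ℕ) := by
    have hlt' : 3 * (A % 3 ^ m) + A / 3 ^ m + 1 < 3 ^ (m + 1) := by
      rw [Nat.succ_eq_add_one, pow_succ] at hA'
      rw [pow_succ]
      generalize A / 3 ^ m = q at *
      interval_cases q <;> omega
    have heq : (3 : ℤ) * A = ((3 * (A % 3 ^ m) + A / 3 ^ m : ℕ) : ℤ)
        + (3 ^ (m + 1) - 1) * ((A / 3 ^ m : ℕ) : ℤ) := by
      zify at hdm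
      push_cast
      rw [pow_succ]
      linear_combination -3 * hdm
    rw [← (Int.mod_modEq j _).mul_left 3, hA, heq, Int.add_mul_emod_self_left]
    zify at hlt'
    exact Int.emod_eq_of_lt (by positivity) (by push_cast; linarith)
  have hi := Nat.mod_lt i hn
  rw [← dig_mod _ j i, dig_congr (Nat.ModEq.add_right 1 (Nat.mod_modEq i (m + 1)).symm)]
  generalize i % (m + 1) = r at *
  rw [dig_eq_of_emod hA hi]
  rcases Nat.lt_or_ge r m with hr | hr
  · rw [dig_eq_of_emod hB (by omega), pow_succ', ← Nat.div_div_eq_div_mul,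
      Nat.mul_add_div (by norm_num), Nat.div_eq_of_lt hq, add_zero]
    conv_rhs => rw [← hdm]
    obtain ⟨l, rfl⟩ := Nat.exists_eq_add_of_lt hr
    generalize A % 3 ^ (r + l + 1) = u
    rw [show 3 ^ (r + l + 1) * (A / 3 ^ (r + l + 1)) + u
      = u + 3 ^ r * (3 * (3 ^ l * (A / 3 ^ (r + l + 1)))) by ring,
      Nat.add_mul_div_left _ _ (by positivity), Nat.add_mul_mod_self_left]
  · obtain rfl : r = m := by omega
    rw [dig_congr (show r + 1 ≡ 0 [MOD r + 1] by simp [Nat.ModEq]), dig_eq_of_emod hB hn]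
    omega

theorem dig_three_pow_mul (n : ℕ) (hn : 0 < n) (k : ℕ) (j : ℤ) (i : ℕ) :
    dig n (3 ^ k * j) (i + k) = dig n j i := by
  induction k with
  | zero => simp
  | succ k ih => rw [pow_succ', mul_assoc, ← add_assoc, dig_three_mul n hn, ih]

theorem even_dig_of_even_dig_neg {n : ℕ} (hn : 0 < n) {y : ℤ}
    (hy : ∀ i < n, Even (dig n (-y) i)) : ∀ i < n, Even (dig n y i) := by
  obtain ⟨t, htn, ht1, ht⟩ := exists_carry n hn y (-y)
  have hzero : ∀ i, dig n (y + -y) i = 0 := by simp [dig]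
  have hstep : ∀ i < n, t i ≤ t (i + 1) := fun i hi => by
    have := ht i hi
    have := ht1 i
    have := hzero i
    omega
  have hle : ∀ i ≤ n, t 0 ≤ t i := fun i => by
    induction i with
    | zero => simp
    | succ i ih => exact fun hi => (ih (by omega)).trans (hstep i hi)
  have hge : ∀ i ≤ n, t i ≤ t n := fun i hi => by
    induction hi using Nat.decreasingInduction with
    | of_succ i hi ih => exact (hstep i hi).trans ih
    | self => exact le_rfl
  intro i hi
  have h := ht i hi
  have hz := hzero i
  have := hle i hi.le
  have := hge i hi.le
  have := hle (i + 1) hi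
  have := hge (i + 1) hi
  have := hy i hi
  rw [Nat.even_iff] at *
  omega

theorem even_dig_of_two_mul_wt_eq {n : ℕ} (hn : 0 < n) {x : ℤ}
    (hx : 2 * wt n x = wt n (x + x)) : ∀ i < n, Even (dig n (x + x) i) := by
  obtain ⟨t, htn, -, ht⟩ := exists_carry n hn x x
  have hsum := sum_carry_eq htn ht
  have hz : ∀ i < n, t (i + 1) = 0 := by
    have : ∑ i ∈ Finset.range n, t (i + 1) = 0 := by omega
    simpa using this
  intro i hi
  have h := ht i hi
  have h1 := hz i hi
  have h0 : t i = 0 := by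
    rcases i with _ | i
    · have := hz (n - 1) (by omega)
      rw [Nat.sub_add_cancel hn] at this
      omega
    · exact hz i (by omega)
  exact ⟨dig n x i, by omega⟩

/-- If `f` is `n`-periodic and invariant under the shift by `k`, except possibly into the residues
`0` and `1`, then walking from `0` in steps of `k` preserves `f` until just before reaching `1`. -/
theorem eq_of_shift_invariant {α : Type*} {n k : ℕ} (hn : 2 ≤ n) (hkn : k < n)
    (hgcd : Nat.gcd n k = 1) {f : ℕ → α} (hper : ∀ i i', i ≡ i' [MOD n] → f i = f i')
    (hf : ∀ i, ¬ i + k ≡ 0 [MOD n] → ¬ i + k ≡ 1 [MOD n] → f (i + k) = f i) :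
    f (n - k + 1) = f 0 := by
  obtain ⟨m, hmn, hm⟩ := Nat.exists_mul_mod_eq_one_of_coprime (Nat.Coprime.symm hgcd) (by omega)
  replace hm : m * k ≡ 1 [MOD n] := by
    rw [Nat.ModEq, mul_comm, hm, Nat.mod_eq_of_lt (by omega)]
  have hm0 : m ≠ 0 := by
    rintro rfl
    rw [zero_mul, Nat.ModEq, Nat.mod_eq_of_lt (by omega), Nat.mod_eq_of_lt (by omega)] at hm
    omega
  have hwalk : ∀ l < m, f (l * k) = f 0 := fun l => by
    induction l with
    | zero => simp
    | succ l ih =>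
      intro hl
      rw [add_mul, one_mul, hf (l * k) _ _, ih (by omega)]
      · intro h
        rw [← Nat.succ_mul, ← Nat.zero_mul k] at h
        have := Nat.ModEq.cancel_right_of_coprime hgcd h
        rw [Nat.ModEq, Nat.mod_eq_of_lt (by omega), Nat.mod_eq_of_lt (by omega)] at this
        omega
      · intro h
        rw [← Nat.succ_mul] at h
        have := Nat.ModEq.cancel_right_of_coprime hgcd (h.trans hm.symm)
        rw [Nat.ModEq, Nat.mod_eq_of_lt (by omega), Nat.mod_eq_of_lt (by omega)] at this
        omega
  rw [← hwalk (m - 1) (by omega)]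
  refine hper _ _ (Nat.ModEq.add_right_cancel' k ?_)
  rw [← Nat.succ_mul, Nat.succ_eq_add_one, Nat.sub_add_cancel (by omega),
    show n - k + 1 + k = n + 1 by omega]
  exact (Nat.add_modEq_left).trans hm.symm

theorem stmt7 (n k : ℕ) (hn : 2 ≤ n) (hkodd : Odd k) (hk0 : 0 < k) (hkn : k < n)
    (hgcd : Nat.gcd n k = 1) (j : ℤ) (hj : j ∈ S1 n k)
    (h0 : (dig n j 0 = 1 ∧ dig n j (n - k) = 2) ∨ (dig n j 0 = 2 ∧ dig n j (n - k) = 1))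
    (h1 : (dig n j 1 = 0 ∧ dig n j (n - k + 1) = 1) ∨
      (dig n j 1 = 1 ∧ dig n j (n - k + 1) = 0)) :
    (dig n j 1 = 1 ∧ dig n j 0 = 2) ∨ (dig n j 1 = 0 ∧ dig n j 0 = 1) := by
  obtain ⟨-, -, hwt, hneg⟩ := hj
  have hn0 : 0 < n := by omega
  have hd : -((3 ^ k + 1) * j) = -(j * cmD k) + -(j * cmD k) := by
    have h2 : (3 ^ k + 1 : ℤ) = 2 * cmD k :=
      (Int.mul_ediv_cancel' (Odd.add_one (Odd.pow (by decide))).two_dvd).symm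
    rw [h2]
    ring
  rw [hd] at hneg
  have heven := even_dig_of_even_dig_neg hn0 (y := (3 ^ k + 1) * j)
    (by rw [hd]; exact even_dig_of_two_mul_wt_eq hn0 hneg)
  obtain ⟨t, htn, -, ht⟩ := exists_carry n hn0 j (3 ^ k * j)
  have hsum := sum_carry_eq htn ht
  rw [show j + 3 ^ k * j = (3 ^ k + 1) * j by ring] at hsum ht
  have hshift : ∀ i, dig n (3 ^ k * j) (i + k) = dig n j i := dig_three_pow_mul n hn0 k j
  have ht1 : 1 ≤ t 1 := by
    have h := ht 0 hn0
    have h3 := dig_lt_three n ((3 ^ k + 1) * j) 0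
    have hs := hshift (n - k)
    rw [Nat.sub_add_cancel hkn.le, dig_congr (show n ≡ 0 [MOD n] by simp [Nat.ModEq])] at hs
    rw [zero_add] at h
    omega
  have htz : ∀ i, 1 < i → i ≤ n → t i = 0 := fun i hi1 hin => by
    have hle : t (0 + 1) + t (i - 1 + 1) ≤ ∑ l ∈ Finset.range n, t (l + 1) :=
      Finset.add_le_sum (f := fun l => t (l + 1)) (fun _ _ => Nat.zero_le _)
        (Finset.mem_range.2 hn0) (Finset.mem_range.2 (by omega)) (by omega)
    rw [Nat.sub_add_cancel (by omega)] at hle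
    simp only [zero_add] at hle
    omega
  have hpar := eq_of_shift_invariant hn hkn hgcd (f := fun i => dig n j i % 2)
    (fun i i' h => by simp only [dig_congr h]) fun i hi0 hi1 => by
      have hlt := Nat.mod_lt (i + k) hn0
      rw [Nat.ModEq, Nat.zero_mod] at hi0
      rw [Nat.ModEq, Nat.mod_eq_of_lt (show 1 < n by omega)] at hi1
      have h := ht _ hlt
      have he := heven _ hlt
      rw [htz _ (by omega) hlt.le, htz _ (by omega) hlt, dig_mod, dig_mod, dig_mod, hshift] at h
      rw [dig_mod, Nat.even_iff] at he
      show dig n j (i + k) % 2 = dig n j i % 2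
      omega
  omega
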